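/- Let p be an odd prime dividing k, k odd, and q a power of p. The expected number of F_{q^k}-points on a p-rank (p−1) Artin-Schreier cover over F_q (two poles), averaged over poles being a pair of distinct F_q-rational points versus a conjugate pair of F_{q^2}-points with equal weight, is q^k + 1 + (p−1) q^{k/p}; when instead k is even and p | k it is q^k + 1 + (p−1)(q^{k/p} − 1); and for p ∤ k it is q^k + 1. The equal weighting is justified because exactly half of the degree-2 monic polynomials over F_q that are not squares are irreducible (q(q−1)/2 out of q^2 − q each). -/

import Mathlib

open Polynomial

open Classical in
/-- Number of `F_{q^k}`-points of the cover `y^p − y = g(x)/x^{d₁}` (poles at `0`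
and `∞`, each contributing one point). -/
noncomputable def laurentPoints (p d1 : ℕ) {K : Type} (L : Type) [Field K] [Field L]
    [Fintype L] [Algebra K L] (g : K[X]) : ℕ :=
  2 + ∑ α : L, (if α = 0 then 0
    else Nat.card {y : L // y ^ p - y = aeval α g / α ^ d1})

open Classical in
/-- Average number of `F_{q^k}`-points over the family `{g/x^{d₁} : deg g = d₂}`
(two `F_q`-rational poles). -/
noncomputable def E1avg (p d1 d2 : ℕ) (K L : Type) [Field K] [Field L] [Fintype L]
    [Algebra K L] : ℝ :=
  (∑' g : {g : K[X] // g.natDegree = d2 ∧ g.coeff 0 ≠ 0},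
      (laurentPoints p d1 L g.1 : ℝ)) /
    (Nat.card {g : K[X] // g.natDegree = d2 ∧ g.coeff 0 ≠ 0} : ℝ)

open Classical in
/-- Number of `F_{q^k}`-points of the cover `y^p − y = g(x)/h(x)^m` with `h` a monic
irreducible quadratic (one point above each pole, including the fiber at `∞`). -/
noncomputable def quadPoints (p m : ℕ) {K : Type} (L : Type) [Field K] [Field L]
    [Fintype L] [Algebra K L] (g h : K[X]) : ℕ :=
  (∑ α : L, if aeval α h = 0 then 1
    else Nat.card {y : L // y ^ p - y = aeval α g / (aeval α h) ^ m})
  + Nat.card {y : L // y ^ p - y = algebraMap K L (g.coeff (2 * m))}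

open Classical in
/-- Average number of `F_{q^k}`-points over the family
`{g/h^m : h monic irreducible quadratic, (g,h) = 1}` (two conjugate poles). -/
noncomputable def E2avg (p m : ℕ) (K L : Type) [Field K] [Field L] [Fintype L]
    [Algebra K L] : ℝ :=
  (∑' gh : {gh : K[X] × K[X] // gh.2.Monic ∧ gh.2.natDegree = 2 ∧
      Irreducible gh.2 ∧ gh.1.natDegree ≤ 2 * m ∧ IsCoprime gh.1 gh.2},
      (quadPoints p m L gh.1.1 gh.1.2 : ℝ)) /
    (Nat.card {gh : K[X] × K[X] // gh.2.Monic ∧ gh.2.natDegree = 2 ∧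
      Irreducible gh.2 ∧ gh.1.natDegree ≤ 2 * m ∧ IsCoprime gh.1 gh.2} : ℝ)

/-- Over a finite field, the image of the Artin–Schreier map is the kernel of the trace. -/
theorem exists_pow_sub_self_eq_iff_trace_eq_zero (p : ℕ) [Fact p.Prime] {L : Type} [Field L]
    [Fintype L] [Algebra (ZMod p) L] (c : L) :
    (∃ y : L, y ^ p - y = c) ↔ Algebra.trace (ZMod p) L c = 0 := by
  have : CharP L p := charP_of_injective_algebraMap' (ZMod p) p
  let σ := FiniteField.frobeniusAlgEquivOfAlgebraic (ZMod p) L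
  have hσ (y : L) : σ y = y ^ p := by
    simp [σ, ZMod.card]
  let φ : L →ₗ[ZMod p] L := σ.toLinearMap - LinearMap.id
  have hφ (y : L) : φ y = y ^ p - y := by simp [φ, hσ]
  have hle : φ.range ≤ (Algebra.trace (ZMod p) L).ker := by
    rintro _ ⟨y, rfl⟩
    simp [φ, Algebra.trace_eq_of_algEquiv]
  have hker : φ.ker = Submodule.span (ZMod p) {1} := by
    ext y
    rw [LinearMap.mem_ker, hφ, sub_eq_zero, ← Subfield.mem_bot_iff_pow_eq_self,
      mem_bot_iff_intCast p, Submodule.mem_span_singleton]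
    constructor
    · rintro ⟨n, rfl⟩
      exact ⟨n, by simp [Algebra.smul_def]⟩
    · rintro ⟨a, rfl⟩
      obtain ⟨n, rfl⟩ := ZMod.intCast_surjective a
      exact ⟨n, by simp [Algebra.smul_def]⟩
  have h1 := φ.finrank_range_add_finrank_ker
  have h2 := (Algebra.trace (ZMod p) L).finrank_range_add_finrank_ker
  rw [hker, finrank_span_singleton one_ne_zero] at h1
  rw [LinearMap.range_eq_top.2 (Algebra.trace_surjective (ZMod p) L), finrank_top,
    Module.finrank_self] at h2
  have heq := Submodule.eq_of_le_of_finrank_eq hle (by omega)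
  rw [← LinearMap.mem_ker, ← heq]
  simp [hφ]

/-- Number of points of `y ^ p - y = c` over a finite field, in terms of the trace of `c`. -/
theorem card_pow_sub_self_eq (p : ℕ) [Fact p.Prime] {L : Type} [Field L]
    [Fintype L] [Algebra (ZMod p) L] (c : L) :
    Nat.card {y : L // y ^ p - y = c} =
      if Algebra.trace (ZMod p) L c = 0 then p else 0 := by
  have : CharP L p := charP_of_injective_algebraMap' (ZMod p) p
  split_ifs with h
  · obtain ⟨y, hy⟩ := (exists_pow_sub_self_eq_iff_trace_eq_zero p c).2 h
    let e : (⊥ : Subfield L) ≃ {y : L // y ^ p - y = c} :=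
      { toFun := fun z => ⟨z.1 + y, by
          have := (Subfield.mem_bot_iff_pow_eq_self (F := L) (p := p)).1 z.2
          rw [add_pow_char]
          linear_combination this + hy⟩
        invFun := fun z => ⟨z.1 - y, by
          rw [Subfield.mem_bot_iff_pow_eq_self (F := L) (p := p), sub_pow_char]
          linear_combination z.2 - hy⟩
        left_inv := fun z => by simp
        right_inv := fun z => by simp }
    rw [← Nat.card_congr e, Subfield.card_bot L p]
  · have : IsEmpty {y : L // y ^ p - y = c} :=
      ⟨fun y => h ((exists_pow_sub_self_eq_iff_trace_eq_zero p c).1 ⟨y.1, y.2⟩)⟩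
    simp

/-- A `ZMod p`-valued additive map takes the value zero on a proportion `1 / p` of any finite
set stable under translations by elements of every given value. -/
theorem mul_card_filter_eq_zero {G : Type*} [AddCommGroup G] (p : ℕ) [NeZero p] (S : Finset G)
    (T : G →+ ZMod p) (h : ∀ a, ∃ v, T v = a ∧ ∀ g ∈ S, g + v ∈ S) :
    p * (S.filter fun g => T g = 0).card = S.card := by
  classical
  have hle (a b : ZMod p) :
      (S.filter fun g => T g = a).card ≤ (S.filter fun g => T g = b).card := by
    obtain ⟨v, hv, hS⟩ := h (b - a)
    refine Finset.card_le_card_of_injOn (· + v) (fun g hg => ?_) (add_left_injective v).injOn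
    simp only [Finset.coe_filter, Set.mem_ofPred_eq] at hg ⊢
    exact ⟨hS g hg.1, by simp [hg.2, hv]⟩
  rw [Finset.card_eq_sum_card_fiberwise (s := S) (f := T) (t := Finset.univ) (fun _ _ => by simp),
    Finset.sum_congr rfl fun a _ => le_antisymm (hle a 0) (hle 0 a)]
  simp [ZMod.card]

/-- The average number of solutions of `y ^ p - y = c` for `c` uniform in a subfield `F`. -/
noncomputable def fiberWeight (p : ℕ) {K L : Type} [Field K] [Field L] [Algebra K L]
    (F : IntermediateField K L) : ℕ :=
  open Classical in if p ∣ Module.finrank F L then p else 1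

theorem sum_card_pow_sub_self_eq (p : ℕ) [Fact p.Prime] {K L : Type} [Field K] [Field L]
    [Fintype K] [Fintype L] [Algebra K L] [Algebra (ZMod p) L] (F : IntermediateField K L)
    {G : Type*} [AddCommGroup G] (S : Finset G) (φ : G →+ L) (hφ : ∀ g, φ g ∈ F)
    (h : ∀ x ∈ F, ∃ v, φ v = x ∧ ∀ g ∈ S, g + v ∈ S) :
    ∑ g ∈ S, Nat.card {y : L // y ^ p - y = φ g} = S.card * fiberWeight p F := by
  classical
  have : CharP L p := charP_of_injective_algebraMap' (ZMod p) p
  have : CharP K p := (algebraMap K L).charP_iff_charP p |>.2 this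
  let := ZMod.algebra K p
  have htr (x : F) : Algebra.trace (ZMod p) L x =
      Module.finrank F L * Algebra.trace (ZMod p) F x := by
    rw [← Algebra.trace_trace (S := F), ← IntermediateField.algebraMap_apply,
      Algebra.trace_algebraMap, map_nsmul, nsmul_eq_mul]
  simp_rw [card_pow_sub_self_eq]
  by_cases hp : p ∣ Module.finrank F L
  · rw [Finset.sum_congr rfl fun g _ => if_pos ?_]
    · simp [fiberWeight, hp]
    · rw [htr ⟨φ g, hφ g⟩, (CharP.cast_eq_zero_iff (ZMod p) p _).2 hp, zero_mul]
  · have hu : (Module.finrank F L : ZMod p) ≠ 0 := by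
      rwa [Ne, CharP.cast_eq_zero_iff (ZMod p) p]
    have := mul_card_filter_eq_zero p S
      ((Algebra.trace (ZMod p) L).toAddMonoidHom.comp φ) fun a => by
        obtain ⟨x, hx⟩ := Algebra.trace_surjective (ZMod p) F (a / Module.finrank F L)
        obtain ⟨v, hv, hS⟩ := h x x.2
        refine ⟨v, ?_, hS⟩
        simp only [AddMonoidHom.comp_apply, LinearMap.toAddMonoidHom_coe, hv, htr, hx]
        field_simp
    simp only [AddMonoidHom.comp_apply, LinearMap.toAddMonoidHom_coe] at this
    rw [fiberWeight, if_neg hp, mul_one, ← this, ← Finset.sum_filter, Finset.sum_const,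
      smul_eq_mul, mul_comm p]
    congr!

/-- A divisor of `X ^ #L - X` has as many roots in the finite field `L` as its degree. -/
theorem card_filter_eval_eq_zero {L : Type} [Field L] [Fintype L] [DecidableEq L] {f : L[X]}
    (hf : f ∣ X ^ Fintype.card L - X) :
    (Finset.univ.filter fun x => f.eval x = 0).card = f.natDegree := by
  have hne : (X ^ Fintype.card L - X : L[X]) ≠ 0 :=
    FiniteField.X_pow_card_sub_X_ne_zero L Fintype.one_lt_card
  have hroots := FiniteField.roots_X_pow_card_sub_X L
  have hs : (X ^ Fintype.card L - X : L[X]).Splits := by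
    rw [splits_iff_card_roots, hroots,
      FiniteField.X_pow_card_sub_X_natDegree_eq _ Fintype.one_lt_card]
    rfl
  have hf0 : f ≠ 0 := ne_zero_of_dvd_ne_zero hne hf
  have hnd : f.roots.Nodup :=
    Multiset.nodup_of_le (roots.le_of_dvd hne hf) (hroots ▸ Finset.univ.nodup)
  rw [(hs.of_dvd hne hf).natDegree_eq_card_roots, ← Multiset.toFinset_card_of_nodup hnd]
  congr 1
  ext x
  simp [hf0]

section Subfields

open IntermediateField

variable {K L : Type} [Field K] [Field L] [Algebra K L]

theorem natDegree_minpoly_mul_finrank [FiniteDimensional K L] (α : L) :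
    (minpoly K α).natDegree * Module.finrank K⟮α⟯ L = Module.finrank K L := by
  rw [← adjoin.finrank (Algebra.IsIntegral.isIntegral α), Module.finrank_mul_finrank]

theorem dvd_finrank_adjoin_iff [FiniteDimensional K L] {p : ℕ} (hp : p.Prime)
    (hpk : p ∣ Module.finrank K L) (α : L) :
    p ∣ Module.finrank K⟮α⟯ L ↔ (minpoly K α).natDegree ∣ Module.finrank K L / p := by
  obtain ⟨n, hn⟩ := hpk
  have h := natDegree_minpoly_mul_finrank (K := K) α
  have hd := minpoly.natDegree_pos (Algebra.IsIntegral.isIntegral (R := K) α)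
  rw [hn, Nat.mul_div_cancel_left _ hp.pos]
  rw [hn] at h
  constructor
  · rintro ⟨c, hc⟩
    refine ⟨c, Nat.eq_of_mul_eq_mul_left hp.pos ?_⟩
    rw [← h, hc]
    ring
  · rintro ⟨c, hc⟩
    refine ⟨c, Nat.eq_of_mul_eq_mul_left hd ?_⟩
    rw [h, hc]
    ring

theorem card_filter_dvd_finrank_adjoin [Fintype K] [Fintype L] {p : ℕ} (hp : p.Prime)
    (hpk : p ∣ Module.finrank K L) :
    (Finset.univ.filter fun α : L => p ∣ Module.finrank K⟮α⟯ L).card =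
      Fintype.card K ^ (Module.finrank K L / p) := by
  classical
  have hn : Module.finrank K L / p ≠ 0 := by
    have := Nat.le_of_dvd Module.finrank_pos hpk
    exact (Nat.div_pos this hp.pos).ne'
  have hdvd : (X ^ Fintype.card K ^ (Module.finrank K L / p) - X : L[X]) ∣
      X ^ Fintype.card L - X := by
    rw [Module.card_eq_pow_finrank (K := K) (V := L)]
    exact dvd_pow_pow_sub_self_of_dvd (Nat.div_dvd_of_dvd hpk)
  rw [← FiniteField.X_pow_card_pow_sub_X_natDegree_eq L hn Fintype.one_lt_card,
    ← card_filter_eval_eq_zero hdvd]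
  congr 1
  ext α
  have hi := minpoly.irreducible (Algebra.IsIntegral.isIntegral (R := K) α)
  simp only [Finset.mem_filter, Finset.mem_univ, true_and]
  rw [dvd_finrank_adjoin_iff hp hpk, hi.natDegree_dvd_iff_dvd_X_pow_card_pow_sub_X,
    minpoly.dvd_iff, Nat.card_eq_fintype_card]
  simp

theorem minpoly_natDegree_eq_of_aeval_eq_zero {h : K[X]} (hi : Irreducible h) (hm : h.Monic)
    {α : L} (hα : aeval α h = 0) : (minpoly K α).natDegree = h.natDegree := by
  rw [minpoly.eq_of_irreducible_of_monic hi hα hm]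

theorem card_filter_aeval_eq_zero [Fintype K] [Fintype L] [DecidableEq L] {h : K[X]} (hi : Irreducible h)
    (hd : h.natDegree ∣ Module.finrank K L) :
    (Finset.univ.filter fun α : L => aeval α h = 0).card = h.natDegree := by
  rw [hi.natDegree_dvd_iff_dvd_X_pow_card_pow_sub_X, Nat.card_eq_fintype_card,
    ← Module.card_eq_pow_finrank] at hd
  have := card_filter_eval_eq_zero (f := h.map (algebraMap K L))
    (by simpa using Polynomial.map_dvd (algebraMap K L) hd)
  simpa [eval_map_algebraMap] using this

theorem aeval_mem_adjoin_simple (α : L) (g : K[X]) : aeval α g ∈ K⟮α⟯ :=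
  algebra_adjoin_le_adjoin K {α} (aeval_mem_adjoin_singleton K α)

theorem exists_aeval_eq_of_mem_adjoin [FiniteDimensional K L] {α x : L} (hx : x ∈ K⟮α⟯) :
    ∃ r : K[X], aeval α r = x ∧ r.natDegree < Module.finrank K L := by
  have hα := Algebra.IsIntegral.isIntegral (R := K) α
  rw [← mem_toSubalgebra, adjoin_simple_toSubalgebra_of_isAlgebraic hα.isAlgebraic,
    Algebra.adjoin_singleton_eq_range_aeval] at hx
  obtain ⟨f, rfl⟩ := hx
  refine ⟨f %ₘ minpoly K α, ?_, ?_⟩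
  · exact aeval_modByMonic_eq_self_of_root (minpoly.aeval K α)
  · refine (natDegree_modByMonic_lt _ (minpoly.monic hα) (minpoly.ne_one K α)).trans_le ?_
    exact Nat.le_of_dvd Module.finrank_pos ⟨_, (natDegree_minpoly_mul_finrank α).symm⟩

end Subfields

section Quadratics

variable {K : Type} [Field K]

theorem X_sub_C_mul_X_sub_C_eq_iff {a b c d : K} :
    ((X - C c) * (X - C d) : K[X]) = (X - C a) * (X - C b) ↔
      (c = a ∧ d = b) ∨ (c = b ∧ d = a) := by
  constructor
  · intro h
    have h0 := congrArg (coeff · 0) h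
    have h1 := congrArg (coeff · 1) h
    simp only [mul_coeff_zero, mul_coeff_one, coeff_sub, coeff_X_zero, coeff_C_zero, coeff_X_one,
      coeff_C_succ] at h0 h1
    have h2 : (c - a) * (c - b) = 0 := by linear_combination -h0 - c * h1
    rcases mul_eq_zero.1 h2 with h3 | h3
    · exact .inl ⟨by linear_combination h3, by linear_combination -h1 - h3⟩
    · exact .inr ⟨by linear_combination h3, by linear_combination -h1 - h3⟩
  · rintro (⟨rfl, rfl⟩ | ⟨rfl, rfl⟩)
    · rfl
    · ring

theorem monic_natDegree_two_iff {f : K[X]} :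
    f.Monic ∧ f.natDegree = 2 ↔ ∃ b c : K, X ^ 2 + C b * X + C c = f := by
  constructor
  · rintro ⟨hm, hd⟩
    refine ⟨f.coeff 1, f.coeff 0, ?_⟩
    have h2 : f.coeff 2 = 1 := by rw [← hd]; exact hm
    conv_rhs => rw [f.as_sum_range_C_mul_X_pow, hd]
    simp [Finset.sum_range_succ, h2]
    ring
  · rintro ⟨b, c, rfl⟩
    have hd : (X ^ 2 + C b * X + C c : K[X]).natDegree = 2 := by compute_degree!
    exact ⟨by rw [Monic, leadingCoeff, hd]; simp, hd⟩

theorem monic_natDegree_two_not_irreducible_iff {f : K[X]} :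
    f.Monic ∧ f.natDegree = 2 ∧ ¬ Irreducible f ↔ ∃ a b : K, (X - C a) * (X - C b) = f := by
  constructor
  · rintro ⟨hm, hd, hi⟩
    have h1 : f ≠ 1 := by rintro rfl; simp at hd
    have : ¬ ∀ a b : K[X], a.Monic → b.Monic → a * b = f → a.natDegree = 0 ∨ b.natDegree = 0 :=
      fun h => hi (hm.irreducible_iff_natDegree.2 ⟨h1, h⟩)
    push Not at this
    obtain ⟨a, b, ha, hb, rfl, ha0, hb0⟩ := this
    rw [ha.natDegree_mul hb] at hd
    refine ⟨-a.coeff 0, -b.coeff 0, ?_⟩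
    have ha1 := ha.eq_X_add_C (by omega)
    have hb1 := hb.eq_X_add_C (by omega)
    conv_rhs => rw [ha1, hb1]
    simp
  · rintro ⟨a, b, rfl⟩
    have hm := (monic_X_sub_C a).mul (monic_X_sub_C b)
    refine ⟨hm, ?_, fun hi => ?_⟩
    · rw [(monic_X_sub_C a).natDegree_mul (monic_X_sub_C b)]
      simp
    · have h0 := hm.irreducible_iff_natDegree.1 hi |>.2 _ _ (monic_X_sub_C a) (monic_X_sub_C b) rfl
      simp at h0

theorem isSquare_X_sub_C_mul_X_sub_C_iff {a b : K} :
    IsSquare ((X - C a) * (X - C b) : K[X]) ↔ a = b := by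
  constructor
  · rintro ⟨r, hr⟩
    have hra : r.eval a = 0 := by
      have := congrArg (eval a) hr
      simpa using this
    obtain ⟨s, rfl⟩ := dvd_iff_isRoot.2 hra
    have h : X - C b = s * ((X - C a) * s) :=
      mul_left_cancel₀ (X_sub_C_ne_zero a) (by rw [hr]; ring)
    have := congrArg (eval a) h
    simpa [sub_eq_zero] using this
  · rintro rfl
    exact ⟨_, rfl⟩

theorem two_mul_card_reducible_nonsquare [Fintype K] :
    2 * Nat.card {f : K[X] // f.Monic ∧ f.natDegree = 2 ∧ ¬ IsSquare f ∧ ¬ Irreducible f} =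
      Fintype.card K ^ 2 - Fintype.card K := by
  classical
  let φ : K × K → K[X] := fun x => (X - C x.1) * (X - C x.2)
  let D : Finset (K × K) := Finset.univ.offDiag
  have hmem (f : K[X]) : f ∈ D.image φ ↔
      f.Monic ∧ f.natDegree = 2 ∧ ¬ IsSquare f ∧ ¬ Irreducible f := by
    have : (f.Monic ∧ f.natDegree = 2 ∧ ¬ IsSquare f ∧ ¬ Irreducible f) ↔
        ¬ IsSquare f ∧ ∃ a b : K, (X - C a) * (X - C b) = f := by
      rw [← monic_natDegree_two_not_irreducible_iff]
      tauto
    rw [this]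
    simp only [D, φ, Finset.mem_image, Finset.mem_offDiag, Finset.mem_univ, true_and, Prod.exists]
    constructor
    · rintro ⟨a, b, hab, rfl⟩
      exact ⟨fun h => hab (isSquare_X_sub_C_mul_X_sub_C_iff.1 h), a, b, rfl⟩
    · rintro ⟨hs, a, b, rfl⟩
      exact ⟨a, b, fun h => hs (isSquare_X_sub_C_mul_X_sub_C_iff.2 h), rfl⟩
  rw [Nat.card_congr (Equiv.subtypeEquivRight fun f => (hmem f).symm), Nat.card_eq_fintype_card,
    Fintype.card_coe, sq, ← Finset.card_univ, ← Finset.offDiag_card,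
    Finset.card_eq_sum_card_image φ, mul_comm, ← smul_eq_mul, ← Finset.sum_const]
  refine Finset.sum_congr rfl fun f hf => ?_
  obtain ⟨⟨a, b⟩, hab, rfl⟩ := Finset.mem_image.1 hf
  have hab' : a ≠ b := by simpa [D] using hab
  rw [← Finset.card_pair (a := (a, b)) (b := (b, a)) (by simp [hab'])]
  congr 1
  ext ⟨c, d⟩
  simp only [Finset.mem_insert, Finset.mem_singleton, Finset.mem_filter, Finset.mem_offDiag,
    Finset.mem_univ, true_and, φ, X_sub_C_mul_X_sub_C_eq_iff, Prod.mk.injEq]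
  grind

theorem two_mul_card_irreducible [Fintype K] :
    2 * Nat.card {f : K[X] // f.Monic ∧ f.natDegree = 2 ∧ Irreducible f} =
      Fintype.card K ^ 2 - Fintype.card K := by
  classical
  let M : Finset K[X] := Finset.univ.image fun x : K × K => X ^ 2 + C x.1 * X + C x.2
  let Q : Finset K[X] := Finset.univ.image fun a : K => (X - C a) * (X - C a)
  have hM (f : K[X]) : f ∈ M ↔ f.Monic ∧ f.natDegree = 2 := by
    simp [M, monic_natDegree_two_iff]
  have hQ (f : K[X]) : f ∈ Q ↔ f.Monic ∧ f.natDegree = 2 ∧ ¬ Irreducible f ∧ IsSquare f := by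
    have : (f.Monic ∧ f.natDegree = 2 ∧ ¬ Irreducible f ∧ IsSquare f) ↔
        IsSquare f ∧ ∃ a b : K, (X - C a) * (X - C b) = f := by
      rw [← monic_natDegree_two_not_irreducible_iff]
      tauto
    rw [this]
    simp only [Q, Finset.mem_image, Finset.mem_univ, true_and]
    constructor
    · rintro ⟨a, rfl⟩
      exact ⟨⟨_, rfl⟩, a, a, rfl⟩
    · rintro ⟨hs, a, b, rfl⟩
      obtain rfl := isSquare_X_sub_C_mul_X_sub_C_iff.1 hs
      exact ⟨a, rfl⟩
  have hMc : M.card = Fintype.card K ^ 2 := by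
    rw [Finset.card_image_of_injective, Finset.card_univ, Fintype.card_prod, sq]
    rintro ⟨b, c⟩ ⟨b', c'⟩ h
    have h0 := congrArg (coeff · 0) h
    have h1 := congrArg (coeff · 1) h
    simp [coeff_X, coeff_C] at h0 h1
    simp [h0, h1]
  have hQc : Q.card = Fintype.card K := by
    rw [Finset.card_image_of_injective, Finset.card_univ]
    intro a b h
    simpa using X_sub_C_mul_X_sub_C_eq_iff.1 h
  have hR := two_mul_card_reducible_nonsquare (K := K)
  have hcard (P : K[X] → Prop) [DecidablePred P] :
      Nat.card {f : K[X] // f.Monic ∧ f.natDegree = 2 ∧ P f} =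
      (M.filter P).card := by
    rw [← Fintype.card_coe, ← Nat.card_eq_fintype_card]
    exact Nat.card_congr (Equiv.subtypeEquivRight fun f => by
      rw [Finset.mem_filter, hM, and_assoc])
  rw [hcard] at hR ⊢
  have h1 := Finset.card_filter_add_card_filter_not (s := M) Irreducible
  have h2 := Finset.card_filter_add_card_filter_not (s := M.filter fun f => ¬ Irreducible f)
    (fun f => IsSquare f)
  have h3 : (M.filter fun f => ¬ Irreducible f).filter (fun f => IsSquare f) = Q := by
    ext f
    simp only [Finset.mem_filter, hM, hQ]
    tauto
  have h4 : (M.filter fun f => ¬ Irreducible f).filter (fun f => ¬ IsSquare f) =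
      M.filter fun f => ¬ IsSquare f ∧ ¬ Irreducible f := by
    ext f
    simp only [Finset.mem_filter]
    tauto
  rw [h3, h4, hQc] at h2
  rw [hMc] at h1
  omega

end Quadratics

section Weights

open IntermediateField

variable {K L : Type} [Field K] [Field L] [Algebra K L]

theorem fiberWeight_eq_one [FiniteDimensional K L] {p : ℕ} (hpk : ¬ p ∣ Module.finrank K L)
    (F : IntermediateField K L) : fiberWeight p F = 1 :=
  if_neg fun h => hpk (h.trans ⟨_, by rw [mul_comm, Module.finrank_mul_finrank K F L]⟩)

theorem fiberWeight_bot {p : ℕ} (hpk : p ∣ Module.finrank K L) :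
    fiberWeight p (⊥ : IntermediateField K L) = p :=
  if_pos (by rwa [IntermediateField.finrank_bot'])

theorem sum_fiberWeight [Fintype K] [Fintype L] {p : ℕ} (hp : p.Prime)
    (hpk : p ∣ Module.finrank K L) :
    ∑ α : L, (fiberWeight p K⟮α⟯ : ℝ) = (Fintype.card K : ℝ) ^ Module.finrank K L +
      (p - 1) * (Fintype.card K : ℝ) ^ (Module.finrank K L / p) := by
  have h (α : L) : (fiberWeight p K⟮α⟯ : ℝ) =
      1 + (p - 1) * if p ∣ Module.finrank K⟮α⟯ L then 1 else 0 := by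
    rw [fiberWeight]
    split_ifs <;> simp
  simp_rw [h, Finset.sum_add_distrib, ← Finset.mul_sum, Finset.sum_boole,
    card_filter_dvd_finrank_adjoin hp hpk]
  simp [Module.card_eq_pow_finrank (K := K) (V := L)]

theorem sum_ite_zero_fiberWeight [Fintype K] [Fintype L] [DecidableEq L] {p : ℕ} :
    ∑ α : L, ((if α = 0 then 0 else fiberWeight p K⟮α⟯ : ℕ) : ℝ) =
      ∑ α : L, (fiberWeight p K⟮α⟯ : ℝ) - fiberWeight p (⊥ : IntermediateField K L) := by
  rw [← adjoin_zero (F := K) (E := L), eq_sub_iff_add_eq,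
    ← Finset.sum_erase_add _ _ (Finset.mem_univ (0 : L)),
    ← Finset.sum_erase_add (f := fun α : L => (fiberWeight p K⟮α⟯ : ℝ)) _ (Finset.mem_univ (0 : L))]
  simp only [if_true, Nat.cast_zero, add_zero, add_left_inj]
  exact Finset.sum_congr rfl fun α hα => by rw [if_neg (Finset.ne_of_mem_erase hα)]

theorem sum_ite_aeval_fiberWeight_of_even [Fintype K] [Fintype L] [DecidableEq L] {p : ℕ}
    (hp : p.Prime) (hodd : Odd p) (hpk : p ∣ Module.finrank K L)
    (hk : Even (Module.finrank K L)) {h : K[X]} (hi : Irreducible h) (hm : h.Monic)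
    (hd : h.natDegree = 2) :
    ∑ α : L, ((if aeval α h = 0 then 1 else fiberWeight p K⟮α⟯ : ℕ) : ℝ) =
      ∑ α : L, (fiberWeight p K⟮α⟯ : ℝ) - 2 * (p - 1) := by
  have hα (α : L) : ((if aeval α h = 0 then 1 else fiberWeight p K⟮α⟯ : ℕ) : ℝ) =
      fiberWeight p K⟮α⟯ - (p - 1) * if aeval α h = 0 then 1 else 0 := by
    split_ifs with h0
    · have : fiberWeight p K⟮α⟯ = p := by
        refine if_pos ?_
        rw [dvd_finrank_adjoin_iff hp hpk, minpoly_natDegree_eq_of_aeval_eq_zero hi hm h0, hd]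
        obtain ⟨n, hn⟩ := hpk
        rw [hn, Nat.even_mul] at hk
        rw [hn, Nat.mul_div_cancel_left _ hp.pos]
        exact (hk.resolve_left (Nat.not_even_iff_odd.2 hodd)).two_dvd
      rw [this]
      push_cast
      ring
    · simp
  simp_rw [hα, Finset.sum_sub_distrib, ← Finset.mul_sum, Finset.sum_boole,
    card_filter_aeval_eq_zero hi (hd ▸ hk.two_dvd), hd]
  push_cast
  ring

theorem sum_ite_aeval_fiberWeight_of_odd [Fintype L] [DecidableEq L] {p : ℕ}
    (hk : Odd (Module.finrank K L)) {h : K[X]} (hi : Irreducible h) (hm : h.Monic)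
    (hd : h.natDegree = 2) :
    ∑ α : L, ((if aeval α h = 0 then 1 else fiberWeight p K⟮α⟯ : ℕ) : ℝ) =
      ∑ α : L, (fiberWeight p K⟮α⟯ : ℝ) := by
  refine Finset.sum_congr rfl fun α _ => ?_
  rw [if_neg fun h0 => ?_]
  have : FiniteDimensional K L := Module.Finite.of_finite
  have h2 := natDegree_minpoly_mul_finrank (K := K) α
  rw [minpoly_natDegree_eq_of_aeval_eq_zero hi hm h0, hd] at h2
  exact Nat.not_even_iff_odd.2 hk (even_iff_two_dvd.2 ⟨_, h2.symm⟩)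

end Weights

section Averages

open IntermediateField

theorem tsum_div_natCard_eq {X : Type*} {P : X → Prop} {S : Finset X} (hS : ∀ x, x ∈ S ↔ P x)
    (hne : S.Nonempty) {f : X → ℝ} {W : ℝ} (h : ∑ x ∈ S, f x = S.card * W) :
    (∑' x : {x // P x}, f x.1) / (Nat.card {x // P x} : ℝ) = W := by
  obtain rfl : (· ∈ S) = P := funext fun x => propext (hS x)
  rw [Finset.tsum_subtype S f, h, Nat.card_eq_fintype_card, Fintype.card_coe]
  have : (S.card : ℝ) ≠ 0 := by exact_mod_cast hne.card_pos.ne'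
  field_simp

theorem finite_setOf_natDegree_le (K : Type) [Field K] [Fintype K] (n : ℕ) :
    {g : K[X] | g.natDegree ≤ n}.Finite := by
  have : Finite (degreeLT K (n + 1)) := Finite.of_equiv _ (degreeLTEquiv K (n + 1)).symm.toEquiv
  refine (Set.toFinite (degreeLT K (n + 1) : Set K[X])).subset fun g hg => ?_
  rw [SetLike.mem_coe, mem_degreeLT]
  exact degree_le_natDegree.trans_lt (by exact_mod_cast Nat.lt_succ_of_le hg)

variable {K L : Type} [Field K] [Fintype K] [Field L] [Fintype L] [Algebra K L]

theorem sum_card_pow_sub_self_eq_aeval_div (p : ℕ) [Fact p.Prime] [Algebra (ZMod p) L] (α : L)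
    (u : K[X]) {c : L} (hc : c ∈ K⟮α⟯) (hc0 : c ≠ 0) (hu : aeval α u ≠ 0) (S : Finset K[X])
    (hS : ∀ g ∈ S, ∀ r : K[X], r.natDegree < Module.finrank K L → g + u * r ∈ S) :
    ∑ g ∈ S, Nat.card {y : L // y ^ p - y = aeval α g / c} = S.card * fiberWeight p K⟮α⟯ := by
  let φ : K[X] →+ L :=
    { toFun := fun g => aeval α g / c
      map_zero' := by simp
      map_add' := fun f g => by rw [map_add, add_div] }
  refine sum_card_pow_sub_self_eq p K⟮α⟯ S φ (fun g => div_mem (aeval_mem_adjoin_simple α g) hc)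
    fun x hx => ?_
  obtain ⟨r, hr, hrd⟩ := exists_aeval_eq_of_mem_adjoin
    (div_mem (mul_mem hx hc) (aeval_mem_adjoin_simple α u))
  refine ⟨u * r, ?_, fun g hg => hS g hg r hrd⟩
  change aeval α (u * r) / c = x
  rw [map_mul, hr]
  field_simp

open Classical in
theorem E1avg_eq (p : ℕ) [Fact p.Prime] [Algebra (ZMod p) L] (d1 : ℕ) {d2 : ℕ}
    (hd : Module.finrank K L < d2) :
    E1avg p d1 d2 K L =
      2 + ∑ α : L, ((if α = 0 then 0 else fiberWeight p K⟮α⟯ : ℕ) : ℝ) := by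
  let S : Finset K[X] := (finite_setOf_natDegree_le K d2).toFinset.filter
    fun g => g.natDegree = d2 ∧ g.coeff 0 ≠ 0
  have hS (g : K[X]) : g ∈ S ↔ g.natDegree = d2 ∧ g.coeff 0 ≠ 0 := by
    simp only [S, Finset.mem_filter, Set.Finite.mem_toFinset, Set.mem_ofPred_eq]
    exact ⟨fun h => h.2, fun h => ⟨h.1.le, h⟩⟩
  have hne : S.Nonempty := by
    have hpos : d2 ≠ 0 := by omega
    refine ⟨X ^ d2 + C 1, (hS _).2 ⟨natDegree_X_pow_add_C, ?_⟩⟩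
    simp [coeff_X_pow, hpos.symm]
  refine tsum_div_natCard_eq hS hne (f := fun g => (laurentPoints p d1 L g : ℝ)) ?_
  have key : ∑ g ∈ S, laurentPoints p d1 L g =
      S.card * (2 + ∑ α : L, if α = 0 then 0 else fiberWeight p K⟮α⟯) := by
    simp_rw [laurentPoints]
    rw [Finset.sum_add_distrib, Finset.sum_comm, mul_add, Finset.mul_sum, Finset.sum_const,
      smul_eq_mul]
    congr 1
    refine Finset.sum_congr rfl fun α _ => ?_
    split_ifs with hα
    · simp
    refine sum_card_pow_sub_self_eq_aeval_div p α X (pow_mem (mem_adjoin_simple_self K α) d1)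
      (pow_ne_zero _ hα) (by simpa) S fun g hg r hr => ?_
    rw [hS] at hg ⊢
    have hlt : (X * r).natDegree < g.natDegree := by
      refine natDegree_mul_le.trans_lt ?_
      rw [natDegree_X, hg.1]
      omega
    exact ⟨by rw [natDegree_add_eq_left_of_natDegree_lt hlt, hg.1], by simpa using hg.2⟩
  exact_mod_cast key

open Classical in
theorem sum_quadPoints_eq (p : ℕ) [Fact p.Prime] [Algebra (ZMod p) L] {m : ℕ}
    (hm : Module.finrank K L < 2 * m) {h : K[X]} (hmon : h.Monic) (hd : h.natDegree = 2)
    {S : Finset K[X]} (hS : ∀ g, g ∈ S ↔ g.natDegree ≤ 2 * m ∧ IsCoprime g h) :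
    ∑ g ∈ S, quadPoints p m L g h = S.card *
      ((∑ α : L, if aeval α h = 0 then 1 else fiberWeight p K⟮α⟯) +
        fiberWeight p (⊥ : IntermediateField K L)) := by
  have hadd (r : K[X]) (hr : r.natDegree + 2 ≤ 2 * m) (g : K[X]) (hg : g ∈ S) :
      g + h * r ∈ S := by
    rw [hS] at hg ⊢
    refine ⟨natDegree_add_le_of_degree_le hg.1 (natDegree_mul_le.trans (by omega)), ?_⟩
    exact hg.2.add_mul_left_left r
  simp_rw [quadPoints]
  rw [Finset.sum_add_distrib, Finset.sum_comm, mul_add, Finset.mul_sum]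
  congr 1
  · refine Finset.sum_congr rfl fun α _ => ?_
    split_ifs with hα
    · simp
    refine sum_card_pow_sub_self_eq_aeval_div p α h
      (pow_mem (aeval_mem_adjoin_simple α h) m)
      (pow_ne_zero _ hα) hα S fun g hg r hr => hadd r (by omega) g hg
  · let φ : K[X] →+ L := (algebraMap K L).toAddMonoidHom.comp (lcoeff K (2 * m)).toAddMonoidHom
    refine sum_card_pow_sub_self_eq p ⊥ S φ (fun g => IntermediateField.algebraMap_mem _ _)
      fun x hx => ?_
    obtain ⟨c, rfl⟩ := IntermediateField.mem_bot.1 hx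
    have hpos := Module.finrank_pos (R := K) (M := L)
    refine ⟨h * (C c * X ^ (2 * m - 2)), ?_, hadd _ ?_⟩
    · change algebraMap K L ((h * (C c * X ^ (2 * m - 2))).coeff (2 * m)) = _
      have h2 : h.coeff 2 = 1 := by rw [← hd]; exact hmon
      obtain ⟨n, hn⟩ : ∃ n, 2 * m = 2 + n := ⟨2 * m - 2, by omega⟩
      rw [mul_left_comm, coeff_C_mul, hn, Nat.add_sub_cancel_left, coeff_mul_X_pow, h2, mul_one]
    · have := natDegree_C_mul_X_pow_le c (2 * m - 2)
      omega

open Classical in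
theorem E2avg_eq (p : ℕ) [Fact p.Prime] [Algebra (ZMod p) L] {m : ℕ}
    (hm : Module.finrank K L < 2 * m) {W : ℝ}
    (hW : ∀ h : K[X], h.Monic → h.natDegree = 2 → Irreducible h →
      ∑ α : L, ((if aeval α h = 0 then 1 else fiberWeight p K⟮α⟯ : ℕ) : ℝ) +
        fiberWeight p (⊥ : IntermediateField K L) = W) :
    E2avg p m K L = W := by
  let D (n : ℕ) : Finset K[X] := (finite_setOf_natDegree_le K n).toFinset
  have hD (n : ℕ) (g : K[X]) : g ∈ D n ↔ g.natDegree ≤ n := by simp [D]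
  let H : Finset K[X] := (D 2).filter fun h => h.Monic ∧ h.natDegree = 2 ∧ Irreducible h
  have hH (h : K[X]) : h ∈ H ↔ h.Monic ∧ h.natDegree = 2 ∧ Irreducible h := by
    simp only [H, Finset.mem_filter, hD]
    exact ⟨fun h => h.2, fun h => ⟨h.2.1.le, h⟩⟩
  let G (h : K[X]) : Finset K[X] := (D (2 * m)).filter fun g => IsCoprime g h
  have hG (h g : K[X]) : g ∈ G h ↔ g.natDegree ≤ 2 * m ∧ IsCoprime g h := by
    simp only [G, Finset.mem_filter, hD]
  let S : Finset (K[X] × K[X]) := (D (2 * m) ×ˢ H).filter fun x => x.1 ∈ G x.2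
  have hSG (x : K[X] × K[X]) : x ∈ S ↔ x.2 ∈ H ∧ x.1 ∈ G x.2 := by
    simp only [S, Finset.mem_filter, Finset.mem_product, hD, hG]
    tauto
  have hS (x : K[X] × K[X]) : x ∈ S ↔ x.2.Monic ∧ x.2.natDegree = 2 ∧
      Irreducible x.2 ∧ x.1.natDegree ≤ 2 * m ∧ IsCoprime x.1 x.2 := by
    rw [hSG, hH, hG]
    tauto
  have hne : S.Nonempty := by
    have hcard := two_mul_card_irreducible (K := K)
    have : 0 < Fintype.card K ^ 2 - Fintype.card K := by
      have := Fintype.one_lt_card (α := K)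
      rw [Nat.sub_pos_iff_lt]
      nlinarith
    obtain ⟨⟨h, hmon, hd, hi⟩⟩ := (Nat.card_pos_iff.1 (by omega :
      0 < Nat.card {f : K[X] // f.Monic ∧ f.natDegree = 2 ∧ Irreducible f})).1
    exact ⟨(1, h), (hS _).2 ⟨hmon, hd, hi, by simp, isCoprime_one_left⟩⟩
  refine tsum_div_natCard_eq hS hne (f := fun x => (quadPoints p m L x.1 x.2 : ℝ)) ?_
  rw [Finset.card_eq_sum_ones, Finset.sum_finset_product_right S H G hSG,
    Finset.sum_finset_product_right S H G hSG]
  push_cast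
  rw [Finset.sum_mul]
  refine Finset.sum_congr rfl fun h hh => ?_
  obtain ⟨hmon, hd, hi⟩ := (hH h).1 hh
  rw [← hW h hmon hd hi, Finset.sum_const, nsmul_one]
  exact_mod_cast sum_quadPoints_eq p hm hmon hd (hG h)

end Averages

/-- Expected number of `F_{q^k}`-points on a `p`-rank `(p−1)` Artin–Schreier cover
(two poles), averaging the two-rational-poles family and the conjugate-quadratic-poles
family with equal weight: `q^k + 1` if `p ∤ k`; `q^k + 1 + (p−1)(q^{k/p} − 1)` if
`p | k`, `k` even; and `q^k + 1 + (p−1)q^{k/p}` if `p | k`, `k` odd. The equal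
weighting is justified since exactly half of the `q² − q` monic quadratics over `F_q`
that are not squares are irreducible. -/
theorem expected_points_rank_p_minus_one (p q k : ℕ) (hp : p.Prime) (hodd : Odd p)
    (hq : ∃ a : ℕ, 0 < a ∧ q = p ^ a) (hk : 0 < k)
    (K L : Type) [Field K] [Fintype K] [Field L] [Fintype L] [Algebra K L]
    [Algebra (ZMod p) L]
    (hK : Fintype.card K = q) (hL : Fintype.card L = q ^ k) :
    (¬ p ∣ k →
      Filter.Tendsto (fun dd : ℕ × ℕ => E1avg p dd.1 dd.2 K L) Filter.atTop
        (nhds ((q : ℝ) ^ k + 1)) ∧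
      Filter.Tendsto (fun m => E2avg p m K L) Filter.atTop
        (nhds ((q : ℝ) ^ k + 1))) ∧
    (p ∣ k → Even k →
      Filter.Tendsto (fun dd : ℕ × ℕ => E1avg p dd.1 dd.2 K L) Filter.atTop
        (nhds ((q : ℝ) ^ k + 1 + (p - 1) * ((q : ℝ) ^ (k / p) - 1))) ∧
      Filter.Tendsto (fun m => E2avg p m K L) Filter.atTop
        (nhds ((q : ℝ) ^ k + 1 + (p - 1) * ((q : ℝ) ^ (k / p) - 1)))) ∧
    (p ∣ k → Odd k →
      Filter.Tendsto (fun dd : ℕ × ℕ => E1avg p dd.1 dd.2 K L) Filter.atTop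
        (nhds ((q : ℝ) ^ k + 1 + (p - 1) * ((q : ℝ) ^ (k / p) - 1))) ∧
      Filter.Tendsto (fun m => E2avg p m K L) Filter.atTop
        (nhds ((q : ℝ) ^ k + 1 + (p - 1) * ((q : ℝ) ^ (k / p) + 1))) ∧
      ((((q : ℝ) ^ k + 1 + (p - 1) * ((q : ℝ) ^ (k / p) - 1))
          + ((q : ℝ) ^ k + 1 + (p - 1) * ((q : ℝ) ^ (k / p) + 1))) / 2
        = (q : ℝ) ^ k + 1 + (p - 1) * (q : ℝ) ^ (k / p))) ∧
    (2 * Nat.card {f : K[X] // f.Monic ∧ f.natDegree = 2 ∧ Irreducible f}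
        = q ^ 2 - q ∧
      2 * Nat.card {f : K[X] // f.Monic ∧ f.natDegree = 2 ∧ ¬ IsSquare f ∧
          ¬ Irreducible f} = q ^ 2 - q) := by
  classical
  have : Fact p.Prime := ⟨hp⟩
  have hcard := Module.card_eq_pow_finrank (K := K) (V := L)
  obtain rfl : Module.finrank K L = k := by
    rw [hL, hK] at hcard
    exact (Nat.pow_right_injective (hK ▸ Fintype.one_lt_card (α := K)) hcard).symm
  subst hK
  have hE1 {W : ℝ} (hW : 2 + ∑ α : L, ((if α = 0 then 0 else
      fiberWeight p (IntermediateField.adjoin K {α}) : ℕ) : ℝ) = W) :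
      Filter.Tendsto (fun dd : ℕ × ℕ => E1avg p dd.1 dd.2 K L) Filter.atTop (nhds W) := by
    refine tendsto_const_nhds.congr' ?_
    filter_upwards [Filter.eventually_ge_atTop (0, Module.finrank K L + 1)] with dd hdd
    rw [E1avg_eq p dd.1 hdd.2, hW]
  have hE2 {W : ℝ} (hW : ∀ h : K[X], h.Monic → h.natDegree = 2 → Irreducible h →
      ∑ α : L, ((if aeval α h = 0 then 1 else
        fiberWeight p (IntermediateField.adjoin K {α}) : ℕ) : ℝ) +
        fiberWeight p (⊥ : IntermediateField K L) = W) :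
      Filter.Tendsto (fun m => E2avg p m K L) Filter.atTop (nhds W) := by
    refine tendsto_const_nhds.congr' ?_
    filter_upwards [Filter.eventually_ge_atTop (Module.finrank K L + 1)] with m hm
    rw [E2avg_eq p (by omega) hW]
  have hE1_dvd (hpk : p ∣ Module.finrank K L) := hE1 (W := (Fintype.card K : ℝ) ^
      Module.finrank K L + 1 + (p - 1) * ((Fintype.card K : ℝ) ^ (Module.finrank K L / p) - 1)) (by
    rw [sum_ite_zero_fiberWeight, sum_fiberWeight hp hpk, fiberWeight_bot hpk]
    ring)
  refine ⟨fun hpk => ⟨hE1 ?_, hE2 fun h _ _ _ => ?_⟩,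
    fun hpk hk => ⟨hE1_dvd hpk, hE2 fun h hm hd hi => ?_⟩,
    fun hpk hk => ⟨hE1_dvd hpk, hE2 fun h hm hd hi => ?_, by ring⟩,
    two_mul_card_irreducible, two_mul_card_reducible_nonsquare⟩
  · simp_rw [sum_ite_zero_fiberWeight, fiberWeight_eq_one hpk]
    simp [hL]
    ring
  · simp_rw [fiberWeight_eq_one hpk]
    simp [hL]
  · rw [sum_ite_aeval_fiberWeight_of_even hp hodd hpk hk hi hm hd, sum_fiberWeight hp hpk,
      fiberWeight_bot hpk]
    ring
  · rw [sum_ite_aeval_fiberWeight_of_odd hk hi hm hd, sum_fiberWeight hp hpk, fiberWeight_bot hpk]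
    ring
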